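/- arXiv:2010.02435 — 2 statements merged into one kernel-verified Lean document; each statement's English description precedes it below -/
import Mathlib

section
/- Let m ≥ 1 be an integer, η > 0, τ > 0, and d > η. Then ∫_{−∞}^{∞} A_m(r) · sin(d r)/(r² + τ²) dr = π · a_m(τ) · e^{−dτ}. -/
open MeasureTheory

noncomputable section

/-- `A_m(z) = ∫₀¹ s (1 − s²)^m sin(η z s) ds`. -/
def Afun (m : ℕ) (η z : ℝ) : ℝ :=
  ∫ s in (0:ℝ)..1, s * (1 - s ^ 2) ^ m * Real.sin (η * z * s)

/-- `a_m(t) = (1/t) ∫₀¹ s (1 − s²)^m sinh(η t s) ds`. -/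
def aCoef (m : ℕ) (η t : ℝ) : ℝ :=
  (1 / t) * ∫ s in (0:ℝ)..1, s * (1 - s ^ 2) ^ m * Real.sinh (η * t * s)

open FourierTransform in
/-- The Fourier transform of the two-sided exponential is a Cauchy density. -/
lemma fourier_exp_neg_abs {τ : ℝ} (hτ : 0 < τ) :
    Integrable (fun x : ℝ ↦ (Real.exp (-(2 * Real.pi * τ * |x|)) : ℂ)) ∧
    𝓕 (fun x : ℝ ↦ (Real.exp (-(2 * Real.pi * τ * |x|)) : ℂ)) =
      fun w : ℝ ↦ ((τ / Real.pi * (w ^ 2 + τ ^ 2)⁻¹ : ℝ) : ℂ) := by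
  have hπ := Real.pi_pos
  have right (w x : ℝ) (hx : x ∈ Set.Ioi (0 : ℝ)) :
      Complex.exp (↑(-2 * Real.pi * x * w) * Complex.I) •
          (Real.exp (-(2 * Real.pi * τ * |x|)) : ℂ) =
        Complex.exp ((-(2 * Real.pi) * (τ + w * Complex.I)) * x) := by
    rw [abs_of_pos hx, Complex.ofReal_exp, smul_eq_mul, ← Complex.exp_add]
    congr 1
    push_cast
    ring
  have left (w x : ℝ) (hx : x ∈ Set.Iic (0 : ℝ)) :
      Complex.exp (↑(-2 * Real.pi * x * w) * Complex.I) •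
          (Real.exp (-(2 * Real.pi * τ * |x|)) : ℂ) =
        Complex.exp ((2 * Real.pi * (τ - w * Complex.I)) * x) := by
    rw [abs_of_nonpos hx, Complex.ofReal_exp, smul_eq_mul, ← Complex.exp_add]
    congr 1
    push_cast
    ring
  have hre (w : ℝ) : (-(2 * Real.pi) * (τ + w * Complex.I) : ℂ).re < 0 := by
    simp
    positivity
  have hre' (w : ℝ) : 0 < (2 * Real.pi * (τ - w * Complex.I) : ℂ).re := by
    simp
    positivity
  have hR (w : ℝ) := (integrableOn_exp_mul_complex_Ioi (hre w) 0).congr_fun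
    (fun x hx ↦ (right w x hx).symm) measurableSet_Ioi
  have hL (w : ℝ) := (integrableOn_exp_mul_complex_Iic (hre' w) 0).congr_fun
    (fun x hx ↦ (left w x hx).symm) measurableSet_Iic
  refine ⟨?_, ?_⟩
  · have h := (hL 0).union (hR 0)
    rw [Set.Iic_union_Ioi, integrableOn_univ] at h
    simpa using h
  · ext w
    rw [Real.fourier_real_eq_integral_exp_smul,
      ← intervalIntegral.integral_Iic_add_Ioi (hL w) (hR w),
      setIntegral_congr_fun measurableSet_Iic (left w),
      setIntegral_congr_fun measurableSet_Ioi (right w),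
      integral_exp_mul_complex_Iic (hre' w), integral_exp_mul_complex_Ioi (hre w)]
    have h1 : (τ + w * Complex.I : ℂ) ≠ 0 := fun h ↦ by
      simpa [hτ.ne'] using congrArg Complex.re h
    have h2 : (τ - w * Complex.I : ℂ) ≠ 0 := fun h ↦ by
      simpa [hτ.ne'] using congrArg Complex.re h
    have h3 : ((w : ℂ) ^ 2 + τ ^ 2) = (τ + w * Complex.I) * (τ - w * Complex.I) := by
      linear_combination (w : ℂ) ^ 2 * Complex.I_sq
    have h4 : (Real.pi : ℂ) ≠ 0 := by exact_mod_cast hπ.ne'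
    push_cast
    rw [h3]
    simp only [mul_zero, Complex.exp_zero]
    field_simp
    ring

lemma integrable_inv_sq_add_sq {τ : ℝ} (hτ : 0 < τ) :
    Integrable (fun r : ℝ ↦ (r ^ 2 + τ ^ 2)⁻¹) := by
  refine ((integrable_inv_one_add_sq.comp_div hτ.ne').const_mul (τ ^ 2)⁻¹).congr (.of_forall ?_)
  intro r
  dsimp only
  rw [← mul_inv]
  congr 1
  field_simp
  ring

lemma integrable_cos_mul_inv_sq_add_sq {τ : ℝ} (hτ : 0 < τ) (k : ℝ) :
    Integrable (fun r : ℝ ↦ Real.cos (k * r) * (r ^ 2 + τ ^ 2)⁻¹) :=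
  (integrable_inv_sq_add_sq hτ).bdd_mul (c := 1)
    (Continuous.aestronglyMeasurable (by fun_prop))
    (.of_forall fun r ↦ by simpa using Real.abs_cos_le_one _)

open FourierTransform in
lemma integral_cos_mul_inv_sq_add_sq {τ : ℝ} (hτ : 0 < τ) (k : ℝ) :
    ∫ r : ℝ, Real.cos (k * r) * (r ^ 2 + τ ^ 2)⁻¹ =
      Real.pi / τ * Real.exp (-(τ * |k|)) := by
  have hπ := Real.pi_pos
  obtain ⟨hf, hF⟩ := fourier_exp_neg_abs hτ
  have hF' : Integrable (𝓕 (fun x : ℝ ↦ (Real.exp (-(2 * Real.pi * τ * |x|)) : ℂ))) := by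
    rw [hF]
    exact ((integrable_inv_sq_add_sq hτ).const_mul _).ofReal
  have h := congrFun (Continuous.fourierInv_fourier_eq (by fun_prop) hf hF') (k / (2 * Real.pi))
  rw [Real.fourierInv_eq', hF] at h
  have hint : Integrable (fun r : ℝ ↦ Complex.exp (↑(2 * Real.pi *
      inner ℝ r (k / (2 * Real.pi))) * Complex.I) •
        ((τ / Real.pi * (r ^ 2 + τ ^ 2)⁻¹ : ℝ) : ℂ)) :=
    ((integrable_inv_sq_add_sq hτ).const_mul _).ofReal.bdd_mul (c := 1)
      (Continuous.aestronglyMeasurable (by fun_prop))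
      (.of_forall fun r ↦ (Complex.norm_exp_ofReal_mul_I _).le)
  have h' := congrArg Complex.re h
  rw [← RCLike.re_eq_complex_re, ← integral_re hint] at h'
  have hre (r : ℝ) : RCLike.re (Complex.exp (↑(2 * Real.pi *
      inner ℝ r (k / (2 * Real.pi))) * Complex.I) •
        ((τ / Real.pi * (r ^ 2 + τ ^ 2)⁻¹ : ℝ) : ℂ)) =
      τ / Real.pi * (Real.cos (k * r) * (r ^ 2 + τ ^ 2)⁻¹) := by
    rw [smul_eq_mul, RCLike.re_eq_complex_re, Complex.re_mul_ofReal, Complex.exp_ofReal_mul_I_re]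
    have : 2 * Real.pi * inner ℝ r (k / (2 * Real.pi)) = k * r := by
      simp
      field_simp
    rw [this]
    ring
  simp_rw [hre] at h'
  rw [integral_const_mul, RCLike.re_eq_complex_re, Complex.ofReal_re, abs_div,
    abs_of_pos (by positivity : 0 < 2 * Real.pi)] at h'
  have harg : 2 * Real.pi * τ * (|k| / (2 * Real.pi)) = τ * |k| := by field_simp
  rw [harg] at h'
  rw [← h']
  field_simp

lemma integral_sin_mul_sin_div_sq_add_sq {τ : ℝ} (hτ : 0 < τ) {a d : ℝ} (ha : 0 ≤ a)
    (had : a ≤ d) :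
    ∫ r : ℝ, Real.sin (a * r) * Real.sin (d * r) / (r ^ 2 + τ ^ 2) =
      Real.pi / τ * Real.sinh (a * τ) * Real.exp (-(d * τ)) := by
  have h (r : ℝ) : Real.sin (a * r) * Real.sin (d * r) / (r ^ 2 + τ ^ 2) =
      1 / 2 * (Real.cos ((d - a) * r) * (r ^ 2 + τ ^ 2)⁻¹ -
        Real.cos ((d + a) * r) * (r ^ 2 + τ ^ 2)⁻¹) := by
    rw [sub_mul, add_mul, Real.cos_sub, Real.cos_add]
    ring
  simp_rw [h]
  rw [integral_const_mul, integral_sub (integrable_cos_mul_inv_sq_add_sq hτ _)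
    (integrable_cos_mul_inv_sq_add_sq hτ _), integral_cos_mul_inv_sq_add_sq hτ,
    integral_cos_mul_inv_sq_add_sq hτ, abs_of_nonneg (by linarith), abs_of_nonneg (by linarith),
    Real.sinh_eq, show -(τ * (d - a)) = a * τ + -(d * τ) by ring,
    show -(τ * (d + a)) = -(a * τ) + -(d * τ) by ring, Real.exp_add, Real.exp_add]
  ring

theorem stmt_7 (m : ℕ) (hm : 1 ≤ m) (η τ d : ℝ) (hη : 0 < η) (hτ : 0 < τ) (hd : η < d) :
    (∫ r : ℝ, Afun m η r * Real.sin (d * r) / (r ^ 2 + τ ^ 2))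
      = Real.pi * aCoef m η τ * Real.exp (-(d * τ)) := by
  have hprod : Integrable (Function.uncurry fun r s : ℝ ↦
      s * (1 - s ^ 2) ^ m * (Real.sin (η * s * r) * Real.sin (d * r) / (r ^ 2 + τ ^ 2)))
      (volume.prod (volume.restrict (Set.Ioc 0 1))) := by
    have hg : Integrable (fun s : ℝ ↦ s * (1 - s ^ 2) ^ m) (volume.restrict (Set.Ioc 0 1)) :=
      (Continuous.integrableOn_Icc (by fun_prop)).mono_set Set.Ioc_subset_Icc_self
    refine (((integrable_inv_sq_add_sq hτ).mul_prod hg).bdd_mul (c := 1)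
      (f := fun p : ℝ × ℝ ↦ Real.sin (η * p.2 * p.1) * Real.sin (d * p.1))
      (Continuous.aestronglyMeasurable (by fun_prop)) (.of_forall fun p ↦ ?_)).congr
      (.of_forall fun p ↦ ?_)
    · rw [Real.norm_eq_abs, abs_mul]
      exact mul_le_one₀ (Real.abs_sin_le_one _) (abs_nonneg _) (Real.abs_sin_le_one _)
    · simp only [Function.uncurry]
      ring
  have hA (r : ℝ) : Afun m η r * Real.sin (d * r) / (r ^ 2 + τ ^ 2) =
      ∫ s in Set.Ioc (0 : ℝ) 1,
        s * (1 - s ^ 2) ^ m * (Real.sin (η * s * r) * Real.sin (d * r) / (r ^ 2 + τ ^ 2)) := by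
    rw [Afun, intervalIntegral.integral_of_le zero_le_one, mul_div_assoc, ← integral_mul_const]
    refine integral_congr_ae (.of_forall fun s ↦ ?_)
    simp only [mul_right_comm η r s]
    ring
  simp_rw [hA]
  rw [integral_integral_swap hprod, aCoef, intervalIntegral.integral_of_le zero_le_one,
    ← integral_const_mul, ← integral_const_mul, ← integral_mul_const]
  refine setIntegral_congr_fun measurableSet_Ioc fun s hs ↦ ?_
  rw [integral_const_mul, integral_sin_mul_sin_div_sq_add_sq hτ (mul_nonneg hη.le hs.1.le)
    ((mul_le_of_le_one_right hη.le hs.2).trans hd.le), mul_right_comm η τ s]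
  ring
end
end

section
/- Let f : ℝ³ → ℝ be a continuous function with compact support, and let k > 0. Define u(x) = ∫_{ℝ³} (e^{−k|x−y|}/(4π|x−y|)) f(y) dy. Then u is smooth on the open set ℝ³ \ supp f, and for every x in this set, Δu(x) = k² u(x), where Δ is the Laplacian and supp f is the (closed) support of f. -/
open MeasureTheory

noncomputable section

/-- The partial derivative in the `i`-th coordinate direction. -/
def pd (i : Fin 3) (f : EuclideanSpace ℝ (Fin 3) → ℝ) (x : EuclideanSpace ℝ (Fin 3)) : ℝ :=
  fderiv ℝ f x (EuclideanSpace.single i 1)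

/-- The Laplacian `Δf = ∑ᵢ ∂ᵢ∂ᵢ f`. -/
def lap (f : EuclideanSpace ℝ (Fin 3) → ℝ) (x : EuclideanSpace ℝ (Fin 3)) : ℝ :=
  ∑ i, pd i (pd i f) x

open Topology Filter Metric
open scoped Convolution ContDiff

section Locality

variable {f g : EuclideanSpace ℝ (Fin 3) → ℝ} {x : EuclideanSpace ℝ (Fin 3)}

theorem Filter.EventuallyEq.pd (h : f =ᶠ[𝓝 x] g) (i : Fin 3) : pd i f =ᶠ[𝓝 x] pd i g := by
  filter_upwards [h.fderiv (𝕜 := ℝ)] with y hy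
  simp only [_root_.pd, hy]

theorem Filter.EventuallyEq.lap_eq (h : f =ᶠ[𝓝 x] g) : lap f x = lap g x :=
  Finset.sum_congr rfl fun i _ => ((h.pd i).pd i).eq_of_nhds

end Locality

section Radial

theorem HasDerivAt.hasFDerivAt_comp_norm {F : Type*} [NormedAddCommGroup F]
    [InnerProductSpace ℝ F] {p : ℝ → ℝ} {p' : ℝ} {z : F} (hz : z ≠ 0)
    (hp : HasDerivAt p p' ‖z‖) :
    HasFDerivAt (fun z : F => p ‖z‖) ((p' / ‖z‖) • innerSL ℝ z) z := by
  have hz' : ‖z‖ ≠ 0 := norm_ne_zero_iff.2 hz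
  have hnorm : HasFDerivAt (fun z : F => ‖z‖) (‖z‖⁻¹ • innerSL ℝ z) z := by
    have h := (hasStrictFDerivAt_norm_sq z).hasFDerivAt.sqrt (pow_ne_zero 2 hz')
    simp only [Real.sqrt_sq (norm_nonneg _)] at h
    convert! h using 1
    ext v
    simp
    field_simp
  convert! hp.comp_hasFDerivAt z hnorm using 1
  rw [smul_smul, div_eq_mul_inv]

variable {p : ℝ → ℝ}

theorem pd_comp_norm {r : ℝ} {z : EuclideanSpace ℝ (Fin 3)} (hz : z ≠ 0)
    (hp : HasDerivAt p r ‖z‖) (i : Fin 3) :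
    pd i (fun z => p ‖z‖) z = r / ‖z‖ * z i := by
  simp [pd, (hp.hasFDerivAt_comp_norm hz).fderiv, EuclideanSpace.inner_single_right]

/-- The Laplacian of a radial function whose profile `p` has derivative `r * q r`. -/
theorem lap_comp_norm {q : ℝ → ℝ} {s : ℝ} {z : EuclideanSpace ℝ (Fin 3)} (hz : z ≠ 0)
    (hp : ∀ r, 0 < r → HasDerivAt p (r * q r) r) (hq : HasDerivAt q s ‖z‖) :
    lap (fun z => p ‖z‖) z = s * ‖z‖ + 3 * q ‖z‖ := by
  have hz' : ‖z‖ ≠ 0 := norm_ne_zero_iff.2 hz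
  have hpd : ∀ i, pd i (fun z => p ‖z‖) =ᶠ[𝓝 z] fun w => q ‖w‖ * w i := by
    intro i
    filter_upwards [isOpen_ne.mem_nhds hz] with w hw
    have hw' : ‖w‖ ≠ 0 := norm_ne_zero_iff.2 hw
    rw [pd_comp_norm hw (hp _ (norm_pos_iff.2 hw))]
    field_simp
  have hpd2 : ∀ i, pd i (pd i (fun z => p ‖z‖)) z = s / ‖z‖ * z i ^ 2 + q ‖z‖ := by
    intro i
    have hcoord : HasFDerivAt (fun w : EuclideanSpace ℝ (Fin 3) => w i)
        (EuclideanSpace.proj i : EuclideanSpace ℝ (Fin 3) →L[ℝ] ℝ) z :=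
      (EuclideanSpace.proj i : EuclideanSpace ℝ (Fin 3) →L[ℝ] ℝ).hasFDerivAt
    rw [((hpd i).pd i).eq_of_nhds, pd, ((hq.hasFDerivAt_comp_norm hz).fun_mul hcoord).fderiv]
    simp [EuclideanSpace.inner_single_right]
    ring
  have hsq : ∑ i, z i ^ 2 = ‖z‖ ^ 2 := by simp [EuclideanSpace.norm_sq_eq]
  simp only [lap, hpd2, Finset.sum_add_distrib, ← Finset.mul_sum, hsq]
  simp
  field_simp

end Radial

section Yukawa

/-- The fundamental solution `e^{-k|z|} / (4π|z|)` of `k² - Δ`. -/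
def yukawa (k : ℝ) (z : EuclideanSpace ℝ (Fin 3)) : ℝ :=
  Real.exp (-k * ‖z‖) / (4 * Real.pi * ‖z‖)

theorem contDiffAt_yukawa (k : ℝ) {n : ℕ∞ω} {z : EuclideanSpace ℝ (Fin 3)} (hz : z ≠ 0) :
    ContDiffAt ℝ n (yukawa k) z := by
  have hnorm : ContDiffAt ℝ n (fun z : EuclideanSpace ℝ (Fin 3) => ‖z‖) z := contDiffAt_norm ℝ hz
  refine (contDiffAt_const.mul hnorm).exp.div (contDiffAt_const.mul hnorm) ?_
  have := norm_ne_zero_iff.2 hz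
  positivity

theorem lap_yukawa (k : ℝ) {z : EuclideanSpace ℝ (Fin 3)} (hz : z ≠ 0) :
    lap (yukawa k) z = k ^ 2 * yukawa k z := by
  have hπ := Real.pi_ne_zero
  have hexp : ∀ r, HasDerivAt (fun r => Real.exp (-k * r)) (Real.exp (-k * r) * -k) r :=
    fun r => by simpa using ((hasDerivAt_id r).const_mul (-k)).exp
  have hp : ∀ r, 0 < r → HasDerivAt (fun r => Real.exp (-k * r) / (4 * Real.pi * r))
      (r * (-(k * r + 1) * Real.exp (-k * r) / (4 * Real.pi * r ^ 3))) r := by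
    intro r hr
    convert! (hexp r).fun_div ((hasDerivAt_id r).const_mul (4 * Real.pi)) (by
      simp only [id]; positivity) using 1
    simp only [id]
    field_simp
    ring
  have hr : 0 < ‖z‖ := norm_pos_iff.2 hz
  have hlin : HasDerivAt (fun r => -(k * r + 1)) (-k) ‖z‖ := by
    simpa using (((hasDerivAt_id ‖z‖).const_mul k).add_const 1).fun_neg
  have hq := (hlin.fun_mul (hexp ‖z‖)).fun_div ((hasDerivAt_pow 3 ‖z‖).const_mul (4 * Real.pi))
    (by positivity)
  refine (lap_comp_norm hz hp hq).trans ?_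
  simp only [yukawa]
  push_cast
  field_simp
  ring

end Yukawa

section Convolution

variable {f g : EuclideanSpace ℝ (Fin 3) → ℝ}

theorem contDiff_pd (i : Fin 3) (hg : ContDiff ℝ ∞ g) : ContDiff ℝ ∞ (pd i g) :=
  (hg.fderiv_right (m := ∞) (by simp)).clm_apply contDiff_const

theorem hasCompactSupport_pd (i : Fin 3) (hg : HasCompactSupport g) : HasCompactSupport (pd i g) :=
  hg.fderiv_apply ℝ _

theorem pd_convolution (i : Fin 3) (hf : LocallyIntegrable f) (hg : ContDiff ℝ ∞ g)
    (hgs : HasCompactSupport g) :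
    pd i (f ⋆[ContinuousLinearMap.lsmul ℝ ℝ] g) =
      f ⋆[ContinuousLinearMap.lsmul ℝ ℝ] pd i g := by
  ext x
  have hg1 : ContDiff ℝ 1 g := hg.of_le (by simp)
  rw [pd, (hgs.hasFDerivAt_convolution_right _ hf hg1 x).fderiv,
    convolution_precompR_apply _ hf (hgs.fderiv ℝ) (hg1.continuous_fderiv one_ne_zero)]
  rfl

theorem lap_convolution (hf : LocallyIntegrable f) (hg : ContDiff ℝ ∞ g)
    (hgs : HasCompactSupport g) (x : EuclideanSpace ℝ (Fin 3)) :
    lap (f ⋆[ContinuousLinearMap.lsmul ℝ ℝ] g) x = ∫ y, f y * lap g (x - y) := by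
  have hpd2 : ∀ i, pd i (pd i (f ⋆[ContinuousLinearMap.lsmul ℝ ℝ] g)) x =
      ∫ y, f y * pd i (pd i g) (x - y) := by
    intro i
    rw [pd_convolution i hf hg hgs,
      pd_convolution i hf (contDiff_pd i hg) (hasCompactSupport_pd i hgs)]
    rfl
  simp only [lap, hpd2, Finset.mul_sum]
  refine (integral_finsetSum _ fun i _ => ?_).symm
  exact (hasCompactSupport_pd i (hasCompactSupport_pd i hgs)).convolutionExists_right
    (ContinuousLinearMap.lsmul ℝ ℝ) hf (contDiff_pd i (contDiff_pd i hg)).continuous x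

end Convolution

/-- A function smooth away from `0` agrees on any annulus around `0` with a smooth compactly
supported function. -/
theorem exists_contDiff_hasCompactSupport_eqOn_annulus {G : EuclideanSpace ℝ (Fin 3) → ℝ}
    (hG : ∀ z, z ≠ 0 → ContDiffAt ℝ ∞ G z) {r R : ℝ} (hr : 0 < r) (hR : 0 < R) :
    ∃ g : EuclideanSpace ℝ (Fin 3) → ℝ, ContDiff ℝ ∞ g ∧ HasCompactSupport g ∧
      ∀ z, r < ‖z‖ → ‖z‖ < R → g z = G z := by
  let b : ContDiffBump (0 : EuclideanSpace ℝ (Fin 3)) :=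
    ⟨r / 2, r, by positivity, by linarith⟩
  let B : ContDiffBump (0 : EuclideanSpace ℝ (Fin 3)) := ⟨R, R + 1, hR, by linarith⟩
  refine ⟨fun z => B z * ((1 - b z) * G z), ?_, B.hasCompactSupport.mul_right, ?_⟩
  · rw [contDiff_iff_contDiffAt]
    intro z
    rcases eq_or_ne z 0 with rfl | hz
    · refine (contDiffAt_const (c := (0 : ℝ))).congr_of_eventuallyEq ?_
      filter_upwards [b.eventuallyEq_one] with w hw
      simp [hw]
    · exact B.contDiffAt.mul ((contDiffAt_const.sub b.contDiffAt).mul (hG z hz))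
  · intro z hz hzR
    have h1 : b z = 0 := b.zero_of_le_dist (by simpa using hz.le)
    have h2 : B z = 1 := B.one_of_mem_closedBall (by simpa using hzR.le)
    simp [h1, h2]

theorem stmt_12 (f : EuclideanSpace ℝ (Fin 3) → ℝ)
    (hf : Continuous f) (hsupp : HasCompactSupport f)
    (k : ℝ) (hk : 0 < k) (u : EuclideanSpace ℝ (Fin 3) → ℝ)
    (hu : ∀ x, u x = ∫ y, Real.exp (-k * ‖x - y‖) / (4 * Real.pi * ‖x - y‖) * f y) :
    ContDiffOn ℝ (⊤ : ℕ∞) u (tsupport f)ᶜ ∧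
      ∀ x ∈ (tsupport f)ᶜ, lap u x = k ^ 2 * u x := by
  have key : ∀ x ∈ (tsupport f)ᶜ, ContDiffAt ℝ ∞ u x ∧ lap u x = k ^ 2 * u x := by
    intro x hx
    obtain ⟨ε, hε, hball⟩ := Metric.isOpen_iff.1 (isClosed_tsupport f).isOpen_compl x hx
    obtain ⟨M, hM, hKM⟩ := hsupp.isCompact.isBounded.subset_ball_lt 0 x
    have hnear : ∀ y, f y ≠ 0 → ε ≤ ‖x - y‖ := by
      intro y hy
      by_contra! h
      exact hball (by rwa [mem_ball, dist_comm, dist_eq_norm]) (subset_tsupport f hy)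
    have hfar : ∀ y, f y ≠ 0 → ‖x - y‖ < M := by
      intro y hy
      simpa only [mem_ball, dist_comm, dist_eq_norm] using hKM (subset_tsupport f hy)
    obtain ⟨g, hg, hgs, hgG⟩ := exists_contDiff_hasCompactSupport_eqOn_annulus
      (fun z hz => contDiffAt_yukawa k hz) (r := ε / 4) (R := M + ε) (by positivity)
      (by positivity)
    have hannulus : ∀ x' ∈ ball x (ε / 2), ∀ y, f y ≠ 0 →
        ε / 4 < ‖x' - y‖ ∧ ‖x' - y‖ < M + ε := by
      intro x' hx' y hy
      rw [mem_ball, dist_eq_norm] at hx'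
      have h1 := norm_sub_le_norm_sub_add_norm_sub x x' y
      have h2 := norm_sub_le_norm_sub_add_norm_sub x' x y
      rw [norm_sub_rev x x'] at h1
      constructor <;> linarith [hnear y hy, hfar y hy]
    have hconv : u =ᶠ[𝓝 x] f ⋆[ContinuousLinearMap.lsmul ℝ ℝ] g := by
      filter_upwards [ball_mem_nhds x (half_pos hε)] with x' hx'
      rw [hu, convolution_def]
      refine integral_congr_ae (.of_forall fun y => ?_)
      rcases eq_or_ne (f y) 0 with hy | hy
      · simp [hy]
      · obtain ⟨h1, h2⟩ := hannulus x' hx' y hy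
        simp only [ContinuousLinearMap.lsmul_apply, smul_eq_mul, hgG _ h1 h2, yukawa]
        ring
    refine ⟨(hgs.contDiff_convolution_right _ hf.locallyIntegrable hg).contDiffAt
      |>.congr_of_eventuallyEq hconv, ?_⟩
    rw [hconv.lap_eq, lap_convolution hf.locallyIntegrable hg hgs, hu, ← integral_const_mul]
    refine integral_congr_ae (.of_forall fun y => ?_)
    rcases eq_or_ne (f y) 0 with hy | hy
    · simp [hy]
    · obtain ⟨h1, h2⟩ := hannulus x (mem_ball_self (half_pos hε)) y hy
      have hgy : g =ᶠ[𝓝 (x - y)] yukawa k := by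
        filter_upwards [(isOpen_lt continuous_const continuous_norm).mem_nhds h1,
          (isOpen_lt continuous_norm continuous_const).mem_nhds h2] with z using hgG z
      have hne : x - y ≠ 0 := norm_pos_iff.1 (by linarith)
      simp only [hgy.lap_eq, lap_yukawa k hne, yukawa]
      ring
  exact ⟨fun x hx => (key x hx).1.contDiffWithinAt, fun x hx => (key x hx).2⟩
end
end
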